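/- Let K be a field of characteristic 0 and let R = K[x_1,…,x_6, y_1,…,y_6, z_{ij} (1 ≤ i < j ≤ 6)], a polynomial ring in 27 variables with the standard grading. With z_{ji} = −z_{ij}, Z = (z_{ij}), and P = Pf(Z) + Σ_{i≠j} z_{ij} x_i y_j (Pf denoting the 6 × 6 Pfaffian), let I ⊆ R be the ideal generated by the 27 partial derivatives of P. Then the Hilbert series of the graded quotient R/I satisfies Σ_{d ≥ 0} dim_K (R/I)_d · T^d = (1 + 10T + 28T² + 28T³ + 10T⁴ + T⁵) / (1 − T)^{17} as formal power series. -/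

import Mathlib

noncomputable section

open MvPolynomial

/-- Index type for the 27 variables `x₁,…,x₆, y₁,…,y₆, z_{ij} (1 ≤ i < j ≤ 6)`. -/
abbrev E6Var : Type := Fin 6 ⊕ Fin 6 ⊕ {p : Fin 6 × Fin 6 // p.1 < p.2}

/-- The variable `x_i`. -/
def xv (K : Type*) [Field K] (i : Fin 6) : MvPolynomial E6Var K :=
  X (Sum.inl i)

/-- The variable `y_i`. -/
def yv (K : Type*) [Field K] (i : Fin 6) : MvPolynomial E6Var K :=
  X (Sum.inr (Sum.inl i))

/-- The skew-symmetric extension of the variables `z_{ij}`: `z_{ji} = −z_{ij}` and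
`z_{ii} = 0`. -/
def zv (K : Type*) [Field K] (i j : Fin 6) : MvPolynomial E6Var K :=
  if h : i < j then X (Sum.inr (Sum.inr ⟨(i, j), h⟩))
  else if h : j < i then -X (Sum.inr (Sum.inr ⟨(j, i), h⟩))
  else 0

/-- The Pfaffian of the `6 × 6` skew-symmetric matrix `Z = (z_{ij})`, i.e. the signed
sum over the 15 perfect matchings of `{1,…,6}` (0-indexed here). -/
def pfZ (K : Type*) [Field K] : MvPolynomial E6Var K :=
  zv K 0 1 * zv K 2 3 * zv K 4 5 - zv K 0 1 * zv K 2 4 * zv K 3 5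
    + zv K 0 1 * zv K 2 5 * zv K 3 4 - zv K 0 2 * zv K 1 3 * zv K 4 5
    + zv K 0 2 * zv K 1 4 * zv K 3 5 - zv K 0 2 * zv K 1 5 * zv K 3 4
    + zv K 0 3 * zv K 1 2 * zv K 4 5 - zv K 0 3 * zv K 1 4 * zv K 2 5
    + zv K 0 3 * zv K 1 5 * zv K 2 4 - zv K 0 4 * zv K 1 2 * zv K 3 5
    + zv K 0 4 * zv K 1 3 * zv K 2 5 - zv K 0 4 * zv K 1 5 * zv K 2 3
    + zv K 0 5 * zv K 1 2 * zv K 3 4 - zv K 0 5 * zv K 1 3 * zv K 2 4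
    + zv K 0 5 * zv K 1 4 * zv K 2 3

/-- The unique cubic `E₆`-invariant `P = Pf(Z) + ∑_{i ≠ j} z_{ij} x_i y_j`. -/
def cubicP (K : Type*) [Field K] : MvPolynomial E6Var K :=
  pfZ K + ∑ i : Fin 6, ∑ j : Fin 6, if i = j then 0 else zv K i j * xv K i * yv K j

/-- The ideal generated by the 27 partial derivatives of `P`. -/
def e6Ideal (K : Type*) [Field K] : Ideal (MvPolynomial E6Var K) :=
  Ideal.span (Set.range fun v : E6Var => MvPolynomial.pderiv v (cubicP K))

/-- The dimension over `K` of the degree-`d` graded piece of `R/I`, realized as the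
image of the space of degree-`d` homogeneous polynomials in the quotient. -/
def quotPieceDim (K : Type*) [Field K] (d : ℕ) : ℕ :=
  Module.finrank K
    ((MvPolynomial.homogeneousSubmodule E6Var K d).map
      (Ideal.Quotient.mkₐ K (e6Ideal K)).toLinearMap)

/-- The simple root lowered at each step of a reduced word of length 16 carrying the highest
weight of `V` to the lowest one. -/
def rootWord : Fin 16 → Fin 6 := ![0, 2, 3, 1, 4, 3, 2, 0, 5, 4, 3, 1, 2, 3, 4, 5]

/-- The order ideals of the heap of `rootWord`, one for each weight of `V`, encoded in binary and
listed along a linear extension of inclusion. -/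
def idealCode : Fin 27 → ℕ :=
  ![0, 1, 3, 7, 15, 23, 31, 279, 63, 287, 127, 319, 255, 383, 831, 511, 895, 1023, 1919, 2047,
    3967, 4095, 6143, 8191, 16383, 32767, 65535]

/-- The order ideal of the heap attached to a weight. -/
def heapIdeal (x : Fin 27) : Finset (Fin 16) :=
  Finset.univ.filter fun k => (idealCode x).testBit k

/-- The triples `(i, x, y)` such that the weight `y` is the sum of the weight `x` and the simple
root `i`. -/
def weightEdges : List (Fin 6 × Fin 27 × Fin 27) :=
  [(0, 1, 0), (0, 12, 10), (0, 15, 13), (0, 17, 16), (0, 19, 18), (0, 21, 20), (1, 4, 3),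
   (1, 6, 5), (1, 9, 7), (1, 20, 18), (1, 21, 19), (1, 23, 22), (2, 2, 1), (2, 10, 8),
   (2, 13, 11), (2, 16, 14), (2, 22, 19), (2, 23, 21), (3, 3, 2), (3, 8, 6), (3, 11, 9),
   (3, 18, 16), (3, 19, 17), (3, 24, 23), (4, 5, 3), (4, 6, 4), (4, 14, 11), (4, 16, 13),
   (4, 17, 15), (4, 25, 24), (5, 7, 5), (5, 9, 6), (5, 11, 8), (5, 13, 10), (5, 15, 12),
   (5, 26, 25)]

/-- The weight obtained from the weight `x` by adding the simple root `i`, if there is one. -/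
def raise (i : Fin 6) (x : Fin 27) : Option (Fin 27) :=
  (weightEdges.find? fun e => e.1 = i ∧ e.2.1 = x).map fun e => e.2.2

/-- The weight obtained from the weight `x` by subtracting the simple root `i`, if there is one. -/
def lower (i : Fin 6) (x : Fin 27) : Option (Fin 27) :=
  (weightEdges.find? fun e => e.1 = i ∧ e.2.2 = x).map fun e => e.2.1

/-- The cubic form in a weight basis on which the simple root vectors act with coefficients
`0` and `1`: each `(s, a, b, c)` stands for the monomial `s * w a * w b * w c`. -/
def cubicTerms : List (ℤ × Fin 27 × Fin 27 × Fin 27) :=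
  [(1, 0, 12, 26), (-1, 0, 15, 25), (1, 0, 17, 24), (-1, 0, 19, 23), (1, 0, 21, 22),
   (-1, 1, 10, 26), (1, 1, 13, 25), (-1, 1, 16, 24), (1, 1, 18, 23), (-1, 1, 20, 22),
   (1, 2, 8, 26), (-1, 2, 11, 25), (1, 2, 14, 24), (-1, 2, 18, 21), (1, 2, 19, 20),
   (-1, 3, 6, 26), (1, 3, 9, 25), (-1, 3, 14, 23), (1, 3, 16, 21), (-1, 3, 17, 20),
   (1, 4, 5, 26), (-1, 4, 7, 25), (1, 4, 14, 22), (-1, 4, 16, 19), (1, 4, 17, 18),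
   (-1, 5, 9, 24), (1, 5, 11, 23), (-1, 5, 13, 21), (1, 5, 15, 20), (1, 6, 7, 24),
   (-1, 6, 11, 22), (1, 6, 13, 19), (-1, 6, 15, 18), (-1, 7, 8, 23), (1, 7, 10, 21),
   (-1, 7, 12, 20), (1, 8, 9, 22), (-1, 8, 13, 17), (1, 8, 15, 16), (-1, 9, 10, 19),
   (1, 9, 12, 18), (1, 10, 11, 17), (-1, 10, 14, 15), (-1, 11, 12, 16), (1, 12, 13, 14)]

/-- The terms of the partial derivative of the cubic form with respect to the coordinate `x`. -/
def quadricTerms (x : Fin 27) : List (ℤ × Fin 27 × Fin 27) :=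
  cubicTerms.filterMap fun t =>
    if t.2.1 = x then some (t.1, t.2.2.1, t.2.2.2)
    else if t.2.2.1 = x then some (t.1, t.2.1, t.2.2.2)
    else if t.2.2.2 = x then some (t.1, t.2.1, t.2.2.1)
    else none

/-- The quadratic form with the given terms. -/
def evalTerms {A : Type*} [CommRing A] (w : Fin 27 → A) (L : List (ℤ × Fin 27 × Fin 27)) : A :=
  (L.map fun t => (t.1 : A) * (w t.2.1 * w t.2.2)).sum

/-- The partial derivative of the cubic form with respect to the coordinate `x`. -/
def quadric {A : Type*} [CommRing A] (w : Fin 27 → A) (x : Fin 27) : A :=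
  evalTerms w (quadricTerms x)

/-- The action of the one-parameter subgroup of the simple root `i` on coordinates. -/
def rootAct {A : Type*} [CommRing A] (i : Fin 6) (a : A) (w : Fin 27 → A) (x : Fin 27) : A :=
  w x + a * (raise i x).elim 0 w

/-- The terms of the image of a quadratic form under the derivation of the simple root `i`. -/
def raiseTerms (i : Fin 6) (L : List (ℤ × Fin 27 × Fin 27)) : List (ℤ × Fin 27 × Fin 27) :=
  L.flatMap fun t => ((raise i t.2.1).map fun y => (t.1, y, t.2.2)).toList ++
    ((raise i t.2.2).map fun y => (t.1, t.2.1, y)).toList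

set_option maxRecDepth 100000

theorem heapIdeal_injective : Function.Injective heapIdeal := by
  unfold Function.Injective; decide +kernel

theorem heapIdeal_eq_insert_of_raise : ∀ i x y, raise i x = some y → ∃ j, rootWord j = i ∧
    j ∉ heapIdeal y ∧ heapIdeal x = insert j (heapIdeal y) ∧
    ∀ k, rootWord k = i → (k ∈ heapIdeal y ↔ k < j) := by
  decide +kernel

theorem exists_gt_of_raise_eq_none : ∀ i x, raise i x = none → ∀ j, rootWord j = i →
    j ∈ heapIdeal x → ∃ k ∈ heapIdeal x, j < k := by
  decide +kernel

theorem exists_straightening : ∀ a b, ¬ heapIdeal a ⊆ heapIdeal b → ¬ heapIdeal b ⊆ heapIdeal a →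
    ∃ x, ∃ t ∈ quadricTerms x, t.1 * t.1 = 1 ∧ (t.2 = (a, b) ∨ t.2 = (b, a)) ∧
      ∀ u ∈ (quadricTerms x).erase t,
        (heapIdeal a).card ^ 2 + (heapIdeal b).card ^ 2 <
          (heapIdeal u.2.1).card ^ 2 + (heapIdeal u.2.2).card ^ 2 := by
  decide +kernel

theorem quadricTerms_ne : ∀ x, ∀ t ∈ quadricTerms x, t.2.1 ≠ t.2.2 := by decide +kernel

theorem subset_last : ∀ x, heapIdeal x ⊆ heapIdeal 26 := by decide +kernel

theorem le_of_subset : ∀ x y, heapIdeal x ⊆ heapIdeal y → x ≤ y := by decide +kernel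

theorem raise_eq_none_or : ∀ i x, ∀ t ∈ quadricTerms x,
    raise i t.2.1 = none ∨ raise i t.2.2 = none := by
  decide +kernel

/-- The sum of the image of a quadric under the derivation of `i` and of the quadric it cancels. -/
def variationTerms (i : Fin 6) (x : Fin 27) : List (ℤ × Fin 27 × Fin 27) :=
  raiseTerms i (quadricTerms x) ++ (lower i x).elim [] quadricTerms

theorem variationTerms_sign : ∀ i x, ∀ t ∈ variationTerms i x, t.1 ≠ 1 → t.1 = -1 := by
  decide +kernel

theorem variationTerms_perm : ∀ i x, List.Perm
    (((variationTerms i x).filter fun t => t.1 = 1).map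
      fun t => (min t.2.1 t.2.2, max t.2.1 t.2.2))
    (((variationTerms i x).filter fun t => ¬ t.1 = 1).map
      fun t => (min t.2.1 t.2.2, max t.2.1 t.2.2)) := by
  decide +kernel

section

variable {A : Type*} [CommRing A]

@[simp]
theorem evalTerms_nil (w : Fin 27 → A) : evalTerms w [] = 0 := rfl

@[simp]
theorem evalTerms_cons (w : Fin 27 → A) (t : ℤ × Fin 27 × Fin 27)
    (L : List (ℤ × Fin 27 × Fin 27)) :
    evalTerms w (t :: L) = (t.1 : A) * (w t.2.1 * w t.2.2) + evalTerms w L := by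
  simp [evalTerms]

@[simp]
theorem evalTerms_append (w : Fin 27 → A) (L M : List (ℤ × Fin 27 × Fin 27)) :
    evalTerms w (L ++ M) = evalTerms w L + evalTerms w M := by
  simp [evalTerms]

theorem evalTerms_perm (w : Fin 27 → A) {L M : List (ℤ × Fin 27 × Fin 27)} (h : L.Perm M) :
    evalTerms w L = evalTerms w M :=
  (h.map _).sum_eq

theorem evalTerms_eq_of_forall (w : Fin 27 → A) (c : ℤ) {L : List (ℤ × Fin 27 × Fin 27)}
    (h : ∀ t ∈ L, t.1 = c) :
    evalTerms w L = c * ((L.map fun t => (min t.2.1 t.2.2, max t.2.1 t.2.2)).map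
      fun p => w p.1 * w p.2).sum := by
  induction L with
  | nil => simp
  | cons t L ih =>
    have hmm : w (min t.2.1 t.2.2) * w (max t.2.1 t.2.2) = w t.2.1 * w t.2.2 := by
      rcases le_total t.2.1 t.2.2 with hle | hle
      · rw [min_eq_left hle, max_eq_right hle]
      · rw [min_eq_right hle, max_eq_left hle, mul_comm]
    rw [List.forall_mem_cons] at h
    simp [ih h.2, h.1, hmm, mul_add]

theorem evalTerms_eq_zero (w : Fin 27 → A) {L : List (ℤ × Fin 27 × Fin 27)}
    (h : ∀ t ∈ L, t.1 ≠ 1 → t.1 = -1)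
    (hL : ((L.filter fun t => t.1 = 1).map fun t => (min t.2.1 t.2.2, max t.2.1 t.2.2)).Perm
      ((L.filter fun t => ¬ t.1 = 1).map fun t => (min t.2.1 t.2.2, max t.2.1 t.2.2))) :
    evalTerms w L = 0 := by
  have hperm := List.filter_append_perm (fun t : ℤ × Fin 27 × Fin 27 => decide (t.1 = 1)) L
  rw [← evalTerms_perm w hperm, evalTerms_append,
    evalTerms_eq_of_forall w 1 (by simp), evalTerms_eq_of_forall w (-1) (by simpa using h),
    (hL.map _).sum_eq]
  simp

theorem evalTerms_rootAct (i : Fin 6) (a : A) (w : Fin 27 → A)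
    {L : List (ℤ × Fin 27 × Fin 27)}
    (h : ∀ t ∈ L, raise i t.2.1 = none ∨ raise i t.2.2 = none) :
    evalTerms (rootAct i a w) L = evalTerms w L + a * evalTerms w (raiseTerms i L) := by
  induction L with
  | nil => simp [raiseTerms]
  | cons t L ih =>
    rw [List.forall_mem_cons] at h
    have hcons : raiseTerms i (t :: L) =
        (((raise i t.2.1).map fun y => (t.1, y, t.2.2)).toList ++
        ((raise i t.2.2).map fun y => (t.1, t.2.1, y)).toList) ++ raiseTerms i L := rfl
    rw [evalTerms_cons, evalTerms_cons, ih h.2, hcons, evalTerms_append, evalTerms_append]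
    unfold rootAct
    rcases h1 : raise i t.2.1 with _ | y <;> rcases h2 : raise i t.2.2 with _ | z <;>
      simp [h1, h2] at h ⊢ <;> ring

theorem quadric_rootAct (i : Fin 6) (a : A) (w : Fin 27 → A) (x : Fin 27) :
    quadric (rootAct i a w) x = quadric w x - a * (lower i x).elim 0 (quadric w) := by
  have h := evalTerms_eq_zero w (variationTerms_sign i x) (variationTerms_perm i x)
  have hlower : evalTerms w ((lower i x).elim [] quadricTerms) =
      (lower i x).elim 0 (quadric w) := by
    cases lower i x <;> simp [quadric]
  rw [variationTerms, evalTerms_append, hlower] at h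
  unfold quadric at h ⊢
  rw [evalTerms_rootAct i a w (raise_eq_none_or i x)]
  linear_combination a * h

end

/-- The coordinates of the vector obtained from the highest weight vector by letting the first
`k` one-parameter subgroups of `rootWord` act, with independent parameters. -/
def cellPoint (K : Type*) [Field K] : ℕ → Fin 27 → MvPolynomial (Fin 16) K
  | 0 => Pi.single 0 1
  | k + 1 => if h : k < 16 then rootAct (rootWord ⟨k, h⟩) (X ⟨k, h⟩) (cellPoint K k)
      else cellPoint K k

/-- The exponent of the squarefree monomial attached to an order ideal of the heap. -/
def idealExponent (x : Fin 27) : Fin 16 →₀ ℕ :=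
  ∑ k ∈ heapIdeal x, Finsupp.single k 1

theorem idealExponent_apply (x : Fin 27) (k : Fin 16) :
    idealExponent x k = if k ∈ heapIdeal x then 1 else 0 := by
  simp [idealExponent, Finsupp.finsetSum_apply, Finsupp.single_apply]

theorem quadric_cellPoint (K : Type*) [Field K] (k : ℕ) (x : Fin 27) :
    quadric (cellPoint K k) x = 0 := by
  induction k generalizing x with
  | zero =>
    have hterm : ∀ t ∈ quadricTerms x,
        (t.1 : MvPolynomial (Fin 16) K) * (cellPoint K 0 t.2.1 * cellPoint K 0 t.2.2) = 0 := by
      intro t ht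
      have hne := quadricTerms_ne x t ht
      simp only [cellPoint, Pi.single_apply]
      split_ifs with h1 h2 <;> simp_all
    rw [quadric, evalTerms, List.map_congr_left hterm]
    simp
  | succ k ih =>
    rw [cellPoint]
    split_ifs with h
    · rw [quadric_rootAct, ih]
      cases lower (rootWord ⟨k, h⟩) x <;> simp [ih]
    · exact ih x

theorem toSyn_single_lt {j k : Fin 16} (h : j < k) (e : Fin 16 →₀ ℕ) :
    MonomialOrder.lex.toSyn (e + Finsupp.single k 1) <
      MonomialOrder.lex.toSyn (e + Finsupp.single j 1) := by
  rw [map_add, map_add]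
  refine add_lt_add_right ?_ _
  rw [MonomialOrder.lex_lt_iff, Finsupp.Lex.single_lt_iff]
  exact h

theorem cellPoint_leading (K : Type*) [Field K] (k : ℕ) (hk : k ≤ 16) (x : Fin 27) :
    ((∀ j ∈ heapIdeal x, (j : ℕ) < k) → cellPoint K k x ≠ 0 ∧
      MonomialOrder.lex.degree (cellPoint K k x) = idealExponent x) ∧
    (¬ (∀ j ∈ heapIdeal x, (j : ℕ) < k) → cellPoint K k x = 0) := by
  induction k generalizing x with
  | zero =>
    have h0 : heapIdeal 0 = ∅ := by decide +kernel
    by_cases hx : x = 0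
    · subst hx
      simp [cellPoint, h0, idealExponent]
    · have hne : heapIdeal x ≠ ∅ := fun h => hx (heapIdeal_injective (h.trans h0.symm))
      obtain ⟨j, hj⟩ := Finset.nonempty_iff_ne_empty.mpr hne
      exact ⟨fun h => absurd (h j hj) (by simp), fun _ => by simp [cellPoint, hx]⟩
  | succ k ih =>
    have hk' : k < 16 := hk
    have ih := ih hk'.le
    obtain ⟨κ, hκ⟩ : ∃ κ : Fin 16, κ = ⟨k, hk'⟩ := ⟨_, rfl⟩
    have hval : (κ : ℕ) = k := by simp [hκ]
    have hstep : cellPoint K (k + 1) x =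
        cellPoint K k x + X κ * (raise (rootWord κ) x).elim 0 (cellPoint K k) := by
      rw [cellPoint, dif_pos hk', ← hκ, rootAct]
    rcases hr : raise (rootWord κ) x with _ | y
    · have hiff : (∀ j ∈ heapIdeal x, (j : ℕ) < k + 1) ↔ ∀ j ∈ heapIdeal x, (j : ℕ) < k := by
        refine ⟨fun h j hj => lt_of_le_of_ne (Nat.lt_succ_iff.mp (h j hj)) fun hjk => ?_,
          fun h j hj => (h j hj).trans (Nat.lt_succ_self k)⟩
        obtain rfl : j = κ := Fin.ext (hjk.trans hval.symm)
        obtain ⟨l, hl, hlt⟩ := exists_gt_of_raise_eq_none _ x hr j rfl hj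
        have := h l hl
        have : (j : ℕ) < l := hlt
        omega
      rw [hstep, hr, hiff]
      simpa using ih x
    · obtain ⟨j, hj, hjy, hxy, hlab⟩ := heapIdeal_eq_insert_of_raise _ x y hr
      have hκy := hlab κ rfl
      have hexp : idealExponent x = idealExponent y + Finsupp.single j 1 := by
        rw [idealExponent, hxy, Finset.sum_insert hjy, add_comm, idealExponent]
      have hX : (X κ : MvPolynomial (Fin 16) K) ≠ 0 := X_ne_zero κ
      have hdeg (hy : ∀ l ∈ heapIdeal y, (l : ℕ) < k) :
          X κ * cellPoint K k y ≠ 0 ∧ MonomialOrder.lex.degree (X κ * cellPoint K k y) =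
            idealExponent y + Finsupp.single κ 1 := by
        obtain ⟨h0, hd⟩ := (ih y).1 hy
        exact ⟨mul_ne_zero hX h0, by
          rw [MonomialOrder.degree_mul hX h0, MonomialOrder.degree_X, hd, add_comm]⟩
      rw [hstep, hr]
      simp only [Option.elim_some]
      rcases lt_trichotomy j κ with hlt | heq | hgt
      · have hjk : (j : ℕ) < k := hval ▸ hlt
        have hκx : κ ∉ heapIdeal x := by
          rw [hxy, Finset.mem_insert, hκy]
          exact fun h => h.elim hlt.ne' fun h => absurd h hlt.asymm
        have hx1 : (∀ l ∈ heapIdeal x, (l : ℕ) < k + 1) ↔ ∀ l ∈ heapIdeal x, (l : ℕ) < k := by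
          refine ⟨fun h l hl => lt_of_le_of_ne (Nat.lt_succ_iff.mp (h l hl)) fun hlk => ?_,
            fun h l hl => (h l hl).trans (Nat.lt_succ_self k)⟩
          exact hκx ((Fin.ext (hlk.trans hval.symm) : l = κ) ▸ hl)
        have hx2 : (∀ l ∈ heapIdeal x, (l : ℕ) < k) ↔ ∀ l ∈ heapIdeal y, (l : ℕ) < k := by
          rw [hxy, Finset.forall_mem_insert]
          exact and_iff_right hjk
        rw [hx1]
        refine ⟨fun h => ?_, fun h => ?_⟩
        · obtain ⟨h0, hd⟩ := (ih x).1 h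
          obtain ⟨h0', hd'⟩ := hdeg (hx2.1 h)
          have hlt' : MonomialOrder.lex.toSyn (MonomialOrder.lex.degree (X κ * cellPoint K k y)) <
              MonomialOrder.lex.toSyn (MonomialOrder.lex.degree (cellPoint K k x)) := by
            rw [hd', hd, hexp]
            exact toSyn_single_lt hlt _
          have hsum := MonomialOrder.degree_add_of_lt hlt'
          refine ⟨fun h00 => ?_, hsum.trans hd⟩
          rw [eq_neg_of_add_eq_zero_left h00, MonomialOrder.degree_neg] at hlt'
          exact hlt'.false
        · rw [(ih x).2 h, (ih y).2 fun h' => h (hx2.2 h')]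
          simp
      · subst heq
        have hx0 : cellPoint K k x = 0 := (ih x).2 fun h => by
          have := h j (hxy ▸ Finset.mem_insert_self j _)
          omega
        have hx1 : (∀ l ∈ heapIdeal x, (l : ℕ) < k + 1) ↔ ∀ l ∈ heapIdeal y, (l : ℕ) < k := by
          rw [hxy, Finset.forall_mem_insert]
          refine ⟨fun h l hl => lt_of_le_of_ne (Nat.lt_succ_iff.mp (h.2 l hl)) fun hlk => ?_,
            fun h => ⟨by omega, fun l hl => (h l hl).trans (Nat.lt_succ_self k)⟩⟩
          exact hjy ((Fin.ext (hlk.trans hval.symm) : l = j) ▸ hl)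
        rw [hx1, hx0, zero_add, hexp]
        refine ⟨hdeg, fun h => ?_⟩
        rw [(ih y).2 h, mul_zero]
      · have hκ1 : κ ∈ heapIdeal y := hκy.2 hgt
        have hκ2 : κ ∈ heapIdeal x := hxy ▸ Finset.mem_insert_of_mem hκ1
        have hjx : j ∈ heapIdeal x := hxy ▸ Finset.mem_insert_self j _
        have hgt' : (κ : ℕ) < j := hgt
        refine ⟨fun h => absurd (h j hjx) (by omega), fun _ => ?_⟩
        rw [(ih x).2 fun h => by have := h κ hκ2; omega,
          (ih y).2 fun h => by have := h κ hκ1; omega]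
        simp

theorem cellPoint_ne_zero (K : Type*) [Field K] (x : Fin 27) : cellPoint K 16 x ≠ 0 :=
  ((cellPoint_leading K 16 le_rfl x).1 fun j _ => j.isLt).1

theorem degree_cellPoint (K : Type*) [Field K] (x : Fin 27) :
    MonomialOrder.lex.degree (cellPoint K 16 x) = idealExponent x :=
  ((cellPoint_leading K 16 le_rfl x).1 fun j _ => j.isLt).2

theorem linearIndependent_of_degree_injective {K σ ι : Type*} [Field K] (m : MonomialOrder σ)
    {f : ι → MvPolynomial σ K} (hf : ∀ i, f i ≠ 0)
    (hinj : Function.Injective fun i => m.degree (f i)) : LinearIndependent K f := by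
  classical
  rw [linearIndependent_iff']
  intro s g hg
  by_contra! hne
  obtain ⟨i, his, hi⟩ := hne
  obtain ⟨i0, hi0, hmax⟩ := (s.filter fun i => g i ≠ 0).exists_max_image
    (fun i => m.toSyn (m.degree (f i))) ⟨i, by simp [his, hi]⟩
  rw [Finset.mem_filter] at hi0
  have hcoeff := congrArg (coeff (m.degree (f i0))) hg
  rw [coeff_sum, Finset.sum_eq_single_of_mem i0 hi0.1] at hcoeff
  · rw [coeff_smul, coeff_zero, smul_eq_mul, mul_eq_zero] at hcoeff
    exact hcoeff.elim hi0.2 (m.coeff_degree_ne_zero_iff.mpr (hf i0))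
  · intro j hj hji
    rw [coeff_smul, smul_eq_mul]
    by_cases hgj : g j = 0
    · rw [hgj, zero_mul]
    · rw [m.coeff_eq_zero_of_lt, mul_zero]
      refine lt_of_le_of_ne (hmax j (by simp [hj, hgj])) fun h => hji ?_
      exact hinj (m.toSyn.injective h)

theorem list_prod_cellPoint (K : Type*) [Field K] (l : List (Fin 27)) :
    (l.map (cellPoint K 16)).prod ≠ 0 ∧
    MonomialOrder.lex.degree (l.map (cellPoint K 16)).prod = (l.map idealExponent).sum := by
  induction l with
  | nil => simp
  | cons x l ih =>
    rw [List.map_cons, List.prod_cons, List.map_cons, List.sum_cons,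
      MonomialOrder.degree_mul (cellPoint_ne_zero K x) ih.1, ih.2, degree_cellPoint]
    exact ⟨mul_ne_zero (cellPoint_ne_zero K x) ih.1, rfl⟩

theorem heapIdeal_head_eq {x : Fin 27} {l : List (Fin 27)}
    (h : (x :: l).Pairwise fun a b => heapIdeal b ⊆ heapIdeal a) :
    heapIdeal x = (((x :: l).map idealExponent).sum).support := by
  ext k
  have hx : ∀ a ∈ l, heapIdeal a ⊆ heapIdeal x := (List.pairwise_cons.mp h).1
  rw [Finsupp.mem_support_iff, List.map_cons, List.sum_cons, Finsupp.add_apply,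
    idealExponent_apply]
  by_cases hk : k ∈ heapIdeal x
  · simp [hk]
  · have hl : ∀ l' : List (Fin 27), (∀ a ∈ l', heapIdeal a ⊆ heapIdeal x) →
        (l'.map idealExponent).sum k = 0 := by
      intro l' hl'
      induction l' with
      | nil => simp
      | cons a l' ih =>
        rw [List.forall_mem_cons] at hl'
        have hka : k ∉ heapIdeal a := fun h => hk (hl'.1 h)
        simp [idealExponent_apply, hka, ih hl'.2]
    simp [hk, hl l hx]

theorem eq_of_sum_idealExponent_eq {l l' : List (Fin 27)} (hlen : l.length = l'.length)
    (hl : l.Pairwise fun a b => heapIdeal b ⊆ heapIdeal a)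
    (hl' : l'.Pairwise fun a b => heapIdeal b ⊆ heapIdeal a)
    (h : (l.map idealExponent).sum = (l'.map idealExponent).sum) : l = l' := by
  induction l generalizing l' with
  | nil => exact (List.length_eq_zero_iff.mp hlen.symm).symm
  | cons x l ih =>
    obtain _ | ⟨x', l'⟩ := l'
    · simp at hlen
    obtain rfl : x = x' := heapIdeal_injective <| by
      rw [heapIdeal_head_eq hl, heapIdeal_head_eq hl', h]
    rw [List.map_cons, List.map_cons, List.sum_cons, List.sum_cons, add_right_inj] at h
    rw [ih (by simpa using hlen) (List.pairwise_cons.mp hl).2 (List.pairwise_cons.mp hl').2 h]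

/-- The variable of the polynomial ring attached to a weight. -/
def weightVar : Fin 27 → E6Var :=
  ![.inl 0, .inl 1, .inl 2, .inl 3, .inr (.inr ⟨(4, 5), by decide⟩), .inl 4,
    .inr (.inr ⟨(3, 5), by decide⟩), .inl 5, .inr (.inr ⟨(2, 5), by decide⟩),
    .inr (.inr ⟨(3, 4), by decide⟩), .inr (.inr ⟨(1, 5), by decide⟩),
    .inr (.inr ⟨(2, 4), by decide⟩), .inr (.inr ⟨(0, 5), by decide⟩),
    .inr (.inr ⟨(1, 4), by decide⟩), .inr (.inr ⟨(2, 3), by decide⟩),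
    .inr (.inr ⟨(0, 4), by decide⟩), .inr (.inr ⟨(1, 3), by decide⟩),
    .inr (.inr ⟨(0, 3), by decide⟩), .inr (.inr ⟨(1, 2), by decide⟩),
    .inr (.inr ⟨(0, 2), by decide⟩), .inr (.inl 0), .inr (.inl 1),
    .inr (.inr ⟨(0, 1), by decide⟩), .inr (.inl 2), .inr (.inl 3), .inr (.inl 4), .inr (.inl 5)]

/-- The sign relating a variable to the corresponding coordinate in the weight basis. -/
def weightSign : Fin 27 → ℤ :=
  ![1, 1, 1, 1, 1, 1, -1, 1, 1, 1, -1, -1, 1, 1, 1, -1, -1, 1, 1, -1, 1, 1, 1, 1, 1, 1, 1]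

theorem weightVar_bijective : Function.Bijective weightVar := by
  constructor
  · unfold Function.Injective; decide +kernel
  · unfold Function.Surjective; decide +kernel

theorem weightSign_mul_self : ∀ x, weightSign x * weightSign x = 1 := by decide +kernel

theorem cubicTerms_ne : ∀ t ∈ cubicTerms,
    t.2.1 ≠ t.2.2.1 ∧ t.2.1 ≠ t.2.2.2 ∧ t.2.2.1 ≠ t.2.2.2 := by
  decide +kernel

/-- The weights as an indexing of the variables. -/
def weightEquiv : Fin 27 ≃ E6Var := Equiv.ofBijective weightVar weightVar_bijective

/-- The coordinate functions in the weight basis. -/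
def weightCoord (K : Type*) [Field K] (x : Fin 27) : MvPolynomial E6Var K :=
  (weightSign x : MvPolynomial E6Var K) * X (weightVar x)

theorem sign_mul_sign_mul {A : Type*} [Ring A] (x : Fin 27) (f : A) :
    (weightSign x : A) * ((weightSign x : A) * f) = f := by
  rw [← mul_assoc, ← Int.cast_mul, weightSign_mul_self, Int.cast_one, one_mul]

theorem cubicP_eq (K : Type*) [Field K] : cubicP K =
    (cubicTerms.map fun t => (t.1 : MvPolynomial E6Var K) *
      (weightCoord K t.2.1 * weightCoord K t.2.2.1 * weightCoord K t.2.2.2)).sum := by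
  simp [cubicP, pfZ, xv, yv, zv, Fin.sum_univ_succ, cubicTerms, weightCoord, weightVar,
    weightSign]
  ring

theorem pderiv_weightCoord (K : Type*) [Field K] (x y : Fin 27) :
    pderiv (weightVar x) (weightCoord K y) =
      if y = x then (weightSign x : MvPolynomial E6Var K) else 0 := by
  rw [weightCoord, ← zsmul_eq_mul, map_zsmul, pderiv_X, zsmul_eq_mul]
  split_ifs with h
  · subst h; simp
  · rw [Pi.single_eq_of_ne fun h' => h (weightVar_bijective.1 h'), mul_zero]

theorem pderiv_cubicP (K : Type*) [Field K] (x : Fin 27) :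
    pderiv (weightVar x) (cubicP K) =
      (weightSign x : MvPolynomial E6Var K) * quadric (weightCoord K) x := by
  rw [cubicP_eq, quadric, quadricTerms]
  have hne := cubicTerms_ne
  generalize cubicTerms = L at hne ⊢
  induction L with
  | nil => simp
  | cons t L ih =>
    rw [List.forall_mem_cons] at hne
    obtain ⟨⟨h1, h2, h3⟩, hL⟩ := hne
    rw [List.map_cons, List.sum_cons, map_add, ih hL, List.filterMap_cons, ← zsmul_eq_mul,
      map_zsmul, Derivation.leibniz, Derivation.leibniz]
    simp only [pderiv_weightCoord, smul_eq_mul, zsmul_eq_mul]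
    split_ifs <;> first | simp_all; done | (simp; ring)

theorem e6Ideal_eq_span (K : Type*) [Field K] :
    e6Ideal K = Ideal.span (Set.range (quadric (weightCoord K))) := by
  apply le_antisymm <;> rw [e6Ideal, Ideal.span_le] <;> rintro _ ⟨x, rfl⟩
  · obtain ⟨x, rfl⟩ := weightVar_bijective.2 x
    simp only [pderiv_cubicP]
    exact Ideal.mul_mem_left _ _ (Ideal.subset_span ⟨x, rfl⟩)
  · rw [← sign_mul_sign_mul x (quadric (weightCoord K) x), ← pderiv_cubicP]
    exact Ideal.mul_mem_left _ _ (Ideal.subset_span ⟨weightVar x, rfl⟩)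

/-- The parametrization of an open cell of the cone by 16 parameters. -/
def cellHom (K : Type*) [Field K] : MvPolynomial E6Var K →ₐ[K] MvPolynomial (Fin 16) K :=
  aeval fun v => (weightSign (weightEquiv.symm v) : MvPolynomial (Fin 16) K) *
    cellPoint K 16 (weightEquiv.symm v)

theorem cellHom_weightCoord (K : Type*) [Field K] (x : Fin 27) :
    cellHom K (weightCoord K x) = cellPoint K 16 x := by
  have hx : weightEquiv.symm (weightVar x) = x := weightEquiv.symm_apply_apply x
  rw [weightCoord, map_mul, map_intCast, cellHom, aeval_X, hx, sign_mul_sign_mul]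

theorem map_evalTerms {A B F : Type*} [CommRing A] [CommRing B] [FunLike F A B]
    [RingHomClass F A B] (f : F) (w : Fin 27 → A) (L : List (ℤ × Fin 27 × Fin 27)) :
    f (evalTerms w L) = evalTerms (fun x => f (w x)) L := by
  induction L with
  | nil => simp
  | cons t L ih => simp [ih]

theorem cellHom_eq_zero (K : Type*) [Field K] {f : MvPolynomial E6Var K} (hf : f ∈ e6Ideal K) :
    cellHom K f = 0 := by
  have hle : e6Ideal K ≤ RingHom.ker (cellHom K) := by
    rw [e6Ideal_eq_span, Ideal.span_le]
    rintro _ ⟨x, rfl⟩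
    rw [SetLike.mem_coe, RingHom.mem_ker, quadric, map_evalTerms]
    simp only [cellHom_weightCoord]
    exact quadric_cellPoint K 16 x
  exact hle hf

/-- The decreasing chains of weights with `d` elements, all of them below `x`. -/
def chainsBelow : ℕ → Fin 27 → Finset (List (Fin 27))
  | 0, _ => {[]}
  | d + 1, x => (Finset.univ.filter fun y => heapIdeal y ⊆ heapIdeal x).biUnion
      fun y => (chainsBelow d y).image (y :: ·)

theorem mem_chainsBelow {d : ℕ} {x : Fin 27} {l : List (Fin 27)} :
    l ∈ chainsBelow d x ↔
      l.length = d ∧ (x :: l).Pairwise fun a b => heapIdeal b ⊆ heapIdeal a := by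
  induction d generalizing x l with
  | zero =>
    simp only [chainsBelow, Finset.mem_singleton, List.length_eq_zero_iff]
    exact ⟨fun h => by simp [h], fun h => h.1⟩
  | succ d ih =>
    simp only [chainsBelow, Finset.mem_biUnion, Finset.mem_filter, Finset.mem_univ, true_and,
      Finset.mem_image, ih]
    constructor
    · rintro ⟨y, hy, l, ⟨hl, hp⟩, rfl⟩
      refine ⟨by simp [hl], List.pairwise_cons.mpr ⟨?_, hp⟩⟩
      rw [List.forall_mem_cons]
      exact ⟨hy, fun b hb => ((List.pairwise_cons.mp hp).1 b hb).trans hy⟩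
    · rintro ⟨hl, hp⟩
      obtain _ | ⟨y, l⟩ := l
      · simp at hl
      obtain ⟨h1, h2⟩ := List.pairwise_cons.mp hp
      exact ⟨y, h1 y (by simp), l, ⟨by simpa using hl, h2⟩, rfl⟩

theorem mem_chainsBelow_last {d : ℕ} {l : List (Fin 27)} :
    l ∈ chainsBelow d 26 ↔
      l.length = d ∧ l.Pairwise fun a b => heapIdeal b ⊆ heapIdeal a := by
  rw [mem_chainsBelow, List.pairwise_cons]
  exact and_congr_right fun _ => and_iff_right fun b _ => subset_last b

theorem card_chainsBelow_succ (d : ℕ) (x : Fin 27) :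
    (chainsBelow (d + 1) x).card =
      ∑ y with heapIdeal y ⊆ heapIdeal x, (chainsBelow d y).card := by
  rw [chainsBelow, Finset.card_biUnion]
  · exact Finset.sum_congr rfl fun y _ =>
      Finset.card_image_of_injective _ (List.cons_injective)
  · intro y _ z _ hyz
    rw [Function.onFun, Finset.disjoint_left]
    simp only [Finset.mem_image]
    rintro _ ⟨l, _, rfl⟩ ⟨l', _, h⟩
    exact hyz (List.cons_eq_cons.mp h).1.symm

/-- The class in `R/I` of the monomial attached to a list of weights. -/
def chainClass (K : Type*) [Field K] (l : List (Fin 27)) : MvPolynomial E6Var K ⧸ e6Ideal K :=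
  Ideal.Quotient.mkₐ K (e6Ideal K) (l.map (weightCoord K)).prod

theorem linearIndependent_chainClass (K : Type*) [Field K] (d : ℕ) :
    LinearIndependent K fun l : chainsBelow d 26 => chainClass K l := by
  let φ : (MvPolynomial E6Var K ⧸ e6Ideal K) →ₐ[K] MvPolynomial (Fin 16) K :=
    Ideal.Quotient.liftₐ (e6Ideal K) (cellHom K) fun f hf => cellHom_eq_zero K hf
  have hφ (l : List (Fin 27)) : φ (chainClass K l) = (l.map (cellPoint K 16)).prod := by
    change cellHom K _ = _
    rw [map_list_prod, List.map_map]
    congr 1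
    exact List.map_congr_left fun x _ => cellHom_weightCoord K x
  refine LinearIndependent.of_comp φ.toLinearMap ?_
  refine linearIndependent_of_degree_injective MonomialOrder.lex (fun l => ?_) ?_
  · change φ (chainClass K l) ≠ 0
    rw [hφ]
    exact (list_prod_cellPoint K l).1
  · rintro ⟨l, hl⟩ ⟨l', hl'⟩ h
    change MonomialOrder.lex.degree (φ (chainClass K l)) =
      MonomialOrder.lex.degree (φ (chainClass K l')) at h
    rw [hφ, hφ, (list_prod_cellPoint K l).2, (list_prod_cellPoint K l').2] at h
    rw [mem_chainsBelow_last] at hl hl'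
    exact Subtype.ext (eq_of_sum_idealExponent_eq (hl.1.trans hl'.1.symm) hl.2 hl'.2 h)

theorem mk_evalTerms_mul_mem {K : Type*} [Field K] {I : Ideal (MvPolynomial E6Var K)}
    (S : Submodule K (MvPolynomial E6Var K ⧸ I)) (w : Fin 27 → MvPolynomial E6Var K)
    (f : MvPolynomial E6Var K) {L : List (ℤ × Fin 27 × Fin 27)}
    (h : ∀ t ∈ L, Ideal.Quotient.mkₐ K I (w t.2.1 * (w t.2.2 * f)) ∈ S) :
    Ideal.Quotient.mkₐ K I (evalTerms w L * f) ∈ S := by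
  induction L with
  | nil => simp
  | cons t L ih =>
    rw [List.forall_mem_cons] at h
    rw [evalTerms_cons, add_mul, map_add, mul_assoc, mul_assoc, ← zsmul_eq_mul, map_zsmul]
    exact S.add_mem (zsmul_mem h.1 _) (ih h.2)

theorem mk_prod_mem_span (K : Type*) [Field K] (M : Multiset (Fin 27)) :
    Ideal.Quotient.mkₐ K (e6Ideal K) (M.map (weightCoord K)).prod ∈
      Submodule.span K (Set.range fun l : chainsBelow M.card 26 => chainClass K l) := by
  have hbound (N : Multiset (Fin 27)) :
      (N.map fun x => (heapIdeal x).card ^ 2).sum ≤ N.card * 256 := by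
    rw [← Multiset.card_map (fun x => (heapIdeal x).card ^ 2), ← smul_eq_mul]
    refine Multiset.sum_le_card_nsmul _ _ fun n hn => ?_
    obtain ⟨x, _, rfl⟩ := Multiset.mem_map.mp hn
    exact Nat.pow_le_pow_left (card_finset_fin_le _) 2
  induction hn : M.card * 256 - (M.map fun x => (heapIdeal x).card ^ 2).sum
    using Nat.strong_induction_on generalizing M with
  | _ n ih =>
  by_cases hM : ∀ a ∈ M, ∀ b ∈ M, heapIdeal a ⊆ heapIdeal b ∨ heapIdeal b ⊆ heapIdeal a
  · have hsort : M.sort (· ≥ ·) ∈ chainsBelow M.card 26 := by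
      rw [mem_chainsBelow_last]
      refine ⟨Multiset.length_sort .., ?_⟩
      refine (Multiset.pairwise_sort M (· ≥ ·)).imp_of_mem fun {a b} ha hb hab => ?_
      rcases hM a (by simpa using ha) b (by simpa using hb) with h | h
      · rw [le_antisymm (le_of_subset a b h) hab]
      · exact h
    refine Submodule.subset_span ⟨⟨_, hsort⟩, ?_⟩
    change Ideal.Quotient.mkₐ K (e6Ideal K) _ = _
    rw [← Multiset.prod_coe, ← Multiset.map_coe, Multiset.sort_eq]
  · push Not at hM
    obtain ⟨a, ha, b, hb, hab, hba⟩ := hM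
    have hne : b ≠ a := fun h => hab (h ▸ subset_rfl)
    obtain ⟨N, rfl⟩ := Multiset.exists_cons_of_mem ha
    obtain ⟨N, rfl⟩ := Multiset.exists_cons_of_mem ((Multiset.mem_cons.mp hb).resolve_left hne)
    obtain ⟨x, t, ht, hsq, htab, hlt⟩ := exists_straightening a b hab hba
    set S := Submodule.span K
      (Set.range fun l : chainsBelow (a ::ₘ b ::ₘ N).card 26 => chainClass K l)
    set w := weightCoord K
    have hrest : Ideal.Quotient.mkₐ K (e6Ideal K)
        (evalTerms w ((quadricTerms x).erase t) * (N.map w).prod) ∈ S := by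
      refine mk_evalTerms_mul_mem S w _ fun u hu => ?_
      have hmem := ih _ ?_ (u.2.1 ::ₘ u.2.2 ::ₘ N) rfl
      · have hcard : (u.2.1 ::ₘ u.2.2 ::ₘ N).card = (a ::ₘ b ::ₘ N).card := by
          simp only [Multiset.card_cons]
        rw [hcard, Multiset.map_cons, Multiset.map_cons, Multiset.prod_cons,
          Multiset.prod_cons] at hmem
        exact hmem
      · have h1 := hlt u hu
        have h2 := hbound (u.2.1 ::ₘ u.2.2 ::ₘ N)
        simp only [Multiset.map_cons, Multiset.sum_cons, Multiset.card_cons] at h2 hn ⊢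
        omega
    have hquad : quadric w x = (t.1 : MvPolynomial E6Var K) * (w a * w b) +
        evalTerms w ((quadricTerms x).erase t) := by
      rw [quadric, evalTerms_perm w (List.perm_cons_erase ht), evalTerms_cons]
      rcases htab with h | h <;> simp [h, mul_comm (w a)]
    have hmem : quadric w x ∈ e6Ideal K := by
      rw [e6Ideal_eq_span]
      exact Ideal.subset_span ⟨x, rfl⟩
    have hsq' : (t.1 : MvPolynomial E6Var K) * t.1 = 1 := by
      rw [← Int.cast_mul, hsq, Int.cast_one]
    have heq : (((a ::ₘ b ::ₘ N).map w).prod : MvPolynomial E6Var K) =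
        quadric w x * (t.1 * (N.map w).prod) -
          t.1 • (evalTerms w ((quadricTerms x).erase t) * (N.map w).prod) := by
      rw [hquad, Multiset.map_cons, Multiset.map_cons, Multiset.prod_cons, Multiset.prod_cons,
        zsmul_eq_mul]
      linear_combination -(w a * w b * (N.map w).prod) * hsq'
    have hzero : Ideal.Quotient.mkₐ K (e6Ideal K)
        (quadric w x * (t.1 * (N.map w).prod)) = 0 := by
      rw [Ideal.Quotient.mkₐ_eq_mk, Ideal.Quotient.eq_zero_iff_mem]
      exact Ideal.mul_mem_right _ _ hmem
    rw [heq, map_sub, hzero, zero_sub, map_zsmul]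
    exact S.neg_mem (zsmul_mem hrest _)

theorem prod_X_eq (K : Type*) [Field K] (N : Multiset E6Var) :
    ((N.map X).prod : MvPolynomial E6Var K) =
      (N.map fun v => weightSign (weightEquiv.symm v)).prod •
        ((N.map weightEquiv.symm).map (weightCoord K)).prod := by
  induction N using Multiset.induction_on with
  | empty => simp
  | cons v N ih =>
    have hv : (X v : MvPolynomial E6Var K) =
        weightSign (weightEquiv.symm v) * weightCoord K (weightEquiv.symm v) := by
      have : weightVar (weightEquiv.symm v) = v := weightEquiv.apply_symm_apply v
      rw [weightCoord, sign_mul_sign_mul, this]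
    simp only [Multiset.map_cons, Multiset.prod_cons, ih, zsmul_eq_mul, Int.cast_mul]
    rw [hv]
    ring

theorem map_homogeneousSubmodule_eq (K : Type*) [Field K] (d : ℕ) :
    (homogeneousSubmodule E6Var K d).map (Ideal.Quotient.mkₐ K (e6Ideal K)).toLinearMap =
      Submodule.span K (Set.range fun l : chainsBelow d 26 => chainClass K l) := by
  apply le_antisymm
  · rintro _ ⟨f, hf, rfl⟩
    rw [SetLike.mem_coe, mem_homogeneousSubmodule] at hf
    rw [f.as_sum, map_sum]
    refine Submodule.sum_mem _ fun s hs => ?_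
    have hcard : ((Finsupp.toMultiset s).map weightEquiv.symm).card = d := by
      rw [Multiset.card_map, Finsupp.card_toMultiset, ← hf (mem_support_iff.mp hs),
        Finsupp.weight_apply]
      simp [Finsupp.sum]
    have hmon : monomial s (coeff s f) = coeff s f • ((Finsupp.toMultiset s).map X).prod := by
      rw [monomial_eq, Finsupp.toMultiset_map, Finsupp.prod_toMultiset,
        Finsupp.prod_mapDomain_index (by simp) (by intros; rw [pow_add]), smul_eq_C_mul]
    rw [hmon, map_smul, prod_X_eq, map_zsmul]
    refine Submodule.smul_mem _ _ (zsmul_mem ?_ _)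
    have := mk_prod_mem_span K ((Finsupp.toMultiset s).map weightEquiv.symm)
    rwa [hcard] at this
  · rw [Submodule.span_le]
    rintro _ ⟨⟨l, hl⟩, rfl⟩
    refine ⟨_, ?_, rfl⟩
    rw [SetLike.mem_coe, mem_homogeneousSubmodule]
    obtain rfl := (mem_chainsBelow_last.mp hl).1
    change (l.map (weightCoord K)).prod.IsHomogeneous _
    clear hl
    induction l with
    | nil => exact isHomogeneous_one _ _
    | cons x l ih =>
      rw [List.map_cons, List.prod_cons, List.length_cons, add_comm]
      refine IsHomogeneous.mul ?_ ih
      rw [weightCoord, ← map_intCast (C : K →+* _)]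
      exact (isHomogeneous_X K _).C_mul _

theorem quotPieceDim_eq (K : Type*) [Field K] (d : ℕ) :
    quotPieceDim K d = (chainsBelow d 26).card := by
  rw [quotPieceDim, map_homogeneousSubmodule_eq,
    finrank_span_eq_card (linearIndependent_chainClass K d), Fintype.card_coe]

/-- The generating function of the decreasing chains of weights below `x`. -/
def chainSeries (x : Fin 27) : PowerSeries ℚ :=
  PowerSeries.mk fun d => ((chainsBelow d x).card : ℚ)

theorem chainSeries_eq (x : Fin 27) :
    chainSeries x = 1 + PowerSeries.X *
      ∑ y, if heapIdeal y ⊆ heapIdeal x then chainSeries y else 0 := by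
  ext d
  obtain _ | d := d
  · simp [chainSeries, chainsBelow]
  · rw [map_add, PowerSeries.coeff_succ_X_mul, ← Finset.sum_filter, map_sum]
    simp [chainSeries, card_chainsBelow_succ, PowerSeries.coeff_one]

/-- If the weights strictly below `x` are those below `y` or `z`, and those below `y` and `z` are
those below `m`, the generating functions are related by inclusion-exclusion. -/
theorem chainSeries_inclusion_exclusion {x y z m : Fin 27}
    (h : ∀ w, (if heapIdeal w ⊆ heapIdeal x then 1 else 0) +
        (if heapIdeal w ⊆ heapIdeal m then 1 else 0) = (if w = x then 1 else 0) +
        (if heapIdeal w ⊆ heapIdeal y then 1 else 0) +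
        if heapIdeal w ⊆ heapIdeal z then 1 else 0) :
    (1 - PowerSeries.X) * chainSeries x = chainSeries y + chainSeries z - chainSeries m := by
  have hsum : (∑ w, if heapIdeal w ⊆ heapIdeal x then chainSeries w else 0) +
      (∑ w, if heapIdeal w ⊆ heapIdeal m then chainSeries w else 0) = chainSeries x +
      (∑ w, if heapIdeal w ⊆ heapIdeal y then chainSeries w else 0) +
      ∑ w, if heapIdeal w ⊆ heapIdeal z then chainSeries w else 0 := by
    have hx : chainSeries x = ∑ w, if w = x then chainSeries w else 0 := by simp
    rw [hx]
    simp only [← Finset.sum_add_distrib]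
    refine Finset.sum_congr rfl fun w _ => ?_
    have hw := congrArg (fun n : ℕ => (n : PowerSeries ℚ) * chainSeries w) (h w)
    simpa [add_mul] using hw
  linear_combination chainSeries_eq x + chainSeries_eq m - chainSeries_eq y - chainSeries_eq z +
    PowerSeries.X * hsum

theorem chainSeries_step (x y z m : Fin 27)
    (h : ∀ w, (if heapIdeal w ⊆ heapIdeal x then 1 else 0) +
        (if heapIdeal w ⊆ heapIdeal m then 1 else 0) = (if w = x then 1 else 0) +
        (if heapIdeal w ⊆ heapIdeal y then 1 else 0) +
        if heapIdeal w ⊆ heapIdeal z then 1 else 0) {n : ℕ} {g gy gz gm : PowerSeries ℚ}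
    (hy : chainSeries y * (1 - PowerSeries.X) ^ (n + 1) = gy)
    (hz : chainSeries z * (1 - PowerSeries.X) ^ (n + 1) = gz)
    (hm : chainSeries m * (1 - PowerSeries.X) ^ n = gm)
    (hg : gy + gz - (1 - PowerSeries.X) * gm = g) :
    chainSeries x * (1 - PowerSeries.X) ^ (n + 1 + 1) = g := by
  have hx := chainSeries_inclusion_exclusion h
  generalize (1 - PowerSeries.X : PowerSeries ℚ) = u at *
  rw [← hg, ← hy, ← hz, ← hm]
  linear_combination u ^ (n + 1) * hx

theorem chainSeries_step_of_single (x y : Fin 27)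
    (h : ∀ w, (if heapIdeal w ⊆ heapIdeal x then 1 else 0) +
        (if heapIdeal w ⊆ heapIdeal y then 1 else 0) = (if w = x then 1 else 0) +
        (if heapIdeal w ⊆ heapIdeal y then 1 else 0) +
        if heapIdeal w ⊆ heapIdeal y then 1 else 0) {n : ℕ} {g : PowerSeries ℚ}
    (hy : chainSeries y * (1 - PowerSeries.X) ^ n = g) :
    chainSeries x * (1 - PowerSeries.X) ^ (n + 1) = g := by
  rw [← hy]
  linear_combination (1 - PowerSeries.X) ^ n * chainSeries_inclusion_exclusion h

theorem chainSeries_last :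
    chainSeries 26 * (1 - PowerSeries.X) ^ 17 =
      1 + 10 * PowerSeries.X + 28 * PowerSeries.X ^ 2 + 28 * PowerSeries.X ^ 3 +
        10 * PowerSeries.X ^ 4 + PowerSeries.X ^ 5 := by
  let T : PowerSeries ℚ := PowerSeries.X
  have h0 : chainSeries 0 * (1 - PowerSeries.X) ^ 1 = 1 := by
    have hbot : ∀ y, heapIdeal y ⊆ heapIdeal 0 ↔ y = 0 := by decide +kernel
    have h := chainSeries_eq 0
    simp only [hbot, Finset.sum_ite_eq', Finset.mem_univ, if_true] at h
    linear_combination h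
  have h1 := chainSeries_step_of_single 1 0 (by decide +kernel) h0
  have h2 := chainSeries_step_of_single 2 1 (by decide +kernel) h1
  have h3 := chainSeries_step_of_single 3 2 (by decide +kernel) h2
  have h4 := chainSeries_step_of_single 4 3 (by decide +kernel) h3
  have h5 := chainSeries_step_of_single 5 3 (by decide +kernel) h3
  have h6 := chainSeries_step 6 4 5 3 (by decide +kernel) h4 h5 h3
    (g := 1 + T) (by ring)
  have h7 := chainSeries_step_of_single 7 5 (by decide +kernel) h5
  have h8 := chainSeries_step_of_single 8 6 (by decide +kernel) h6
  have h9 := chainSeries_step 9 6 7 5 (by decide +kernel) h6 h7 h5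
    (g := 1 + 2 * T) (by ring)
  have h10 := chainSeries_step_of_single 10 8 (by decide +kernel) h8
  have h11 := chainSeries_step 11 8 9 6 (by decide +kernel) h8 h9 h6
    (g := 1 + 3 * T + T ^ 2) (by ring)
  have h12 := chainSeries_step_of_single 12 10 (by decide +kernel) h10
  have h13 := chainSeries_step 13 10 11 8 (by decide +kernel) h10 h11 h8
    (g := 1 + 4 * T + 2 * T ^ 2) (by ring)
  have h14 := chainSeries_step_of_single 14 11 (by decide +kernel) h11
  have h15 := chainSeries_step 15 12 13 10 (by decide +kernel) h12 h13 h10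
    (g := 1 + 5 * T + 3 * T ^ 2) (by ring)
  have h16 := chainSeries_step 16 13 14 11 (by decide +kernel) h13 h14 h11
    (g := 1 + 5 * T + 5 * T ^ 2 + T ^ 3) (by ring)
  have h17 := chainSeries_step 17 15 16 13 (by decide +kernel) h15 h16 h13
    (g := 1 + 7 * T + 10 * T ^ 2 + 3 * T ^ 3) (by ring)
  have h18 := chainSeries_step_of_single 18 16 (by decide +kernel) h16
  have h19 := chainSeries_step 19 17 18 16 (by decide +kernel) h17 h18 h16
    (g := 1 + 8 * T + 15 * T ^ 2 + 8 * T ^ 3 + T ^ 4) (by ring)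
  have h20 := chainSeries_step_of_single 20 18 (by decide +kernel) h18
  have h21 := chainSeries_step 21 19 20 18 (by decide +kernel) h19 h20 h18
    (g := 1 + 9 * T + 20 * T ^ 2 + 13 * T ^ 3 + 2 * T ^ 4) (by ring)
  have h22 := chainSeries_step_of_single 22 19 (by decide +kernel) h19
  have h23 := chainSeries_step 23 21 22 19 (by decide +kernel) h21 h22 h19
    (g := 1 + 10 * T + 28 * T ^ 2 + 28 * T ^ 3 + 10 * T ^ 4 + T ^ 5) (by ring)
  have h24 := chainSeries_step_of_single 24 23 (by decide +kernel) h23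
  have h25 := chainSeries_step_of_single 25 24 (by decide +kernel) h24
  have h26 := chainSeries_step_of_single 26 25 (by decide +kernel) h25
  exact h26

/-- In characteristic `0`, the Hilbert series of `R/I` is
`(1 + 10T + 28T² + 28T³ + 10T⁴ + T⁵) / (1 − T)^17`. -/
theorem statement14 (K : Type*) [Field K] [CharZero K] :
    (PowerSeries.mk fun d => (quotPieceDim K d : ℚ)) =
      ((1 + 10 * PowerSeries.X + 28 * PowerSeries.X ^ 2 + 28 * PowerSeries.X ^ 3
          + 10 * PowerSeries.X ^ 4 + PowerSeries.X ^ 5 : PowerSeries ℚ)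
        * (((1 - PowerSeries.X : PowerSeries ℚ)) ^ 17)⁻¹ : PowerSeries ℚ) := by
  have hseries : (PowerSeries.mk fun d => (quotPieceDim K d : ℚ)) = chainSeries 26 := by
    ext d
    simp [chainSeries, quotPieceDim_eq]
  rw [hseries, PowerSeries.eq_mul_inv_iff_mul_eq (by simp)]
  exact chainSeries_last
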